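/- If T is a finite transducer with input alphabet A and output alphabet B, and ω is an almost periodic sequence over A such that the output T(ω) is infinite, then T(ω) is an almost periodic sequence over B. -/

import Mathlib

/-- The segment of a sequence `ω` of length `l` starting at position `i`,
i.e. the string `ω(i)ω(i+1)…ω(i+l-1)`. -/
def seg {A : Type*} (ω : ℕ → A) (i l : ℕ) : List A :=
  List.ofFn (fun k : Fin l => ω (i + k))

/-- The string `x` occurs in the sequence `ω` starting at position `i`. -/
def OccursAt {A : Type*} (ω : ℕ → A) (x : List A) (i : ℕ) : Prop :=
  seg ω i x.length = x

/-- A sequence is almost periodic if every string occurring in it infinitely many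
times occurs in every segment of some fixed length `l`. -/
def AlmostPeriodic {A : Type*} (ω : ℕ → A) : Prop :=
  ∀ x : List A, (∀ N, ∃ i, N ≤ i ∧ OccursAt ω x i) →
    ∃ l, ∀ i, ∃ j, i ≤ j ∧ j + x.length ≤ i + l ∧ OccursAt ω x j

/-- The state of the finite transducer with translation function `f` and initial state
`init` before reading the `n`-th symbol of the input sequence `α`. -/
def transState {A Q B : Type*} (f : Q × A → Q × List B) (init : Q) (α : ℕ → A) : ℕ → Q
  | 0 => init
  | n + 1 => (f (transState f init α n, α n)).1

/-- The finite string output by the transducer upon reading the `n`-th input symbol. -/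
def transOut {A Q B : Type*} (f : Q × A → Q × List B) (init : Q) (α : ℕ → A) (n : ℕ) :
    List B :=
  (f (transState f init α n, α n)).2

/-- The total length of the strings `v 0, …, v (n-1)`, i.e. the position in the
concatenation `v₀v₁v₂…` where `v n` starts. -/
def concatPos {B : Type*} (v : ℕ → List B) (n : ℕ) : ℕ :=
  ∑ m ∈ Finset.range n, (v m).length

/-- The concatenation `v₀v₁v₂…` is infinite. -/
def ConcatInfinite {B : Type*} (v : ℕ → List B) : Prop :=
  ∀ N, ∃ n, N < concatPos v n

/-- The sequence `β` is the concatenation `v₀v₁v₂…` of the finite strings `v n`. -/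
def IsConcatOf {B : Type*} (β : ℕ → B) (v : ℕ → List B) : Prop :=
  ∀ n k, ∀ hk : k < (v n).length, β (concatPos v n + k) = (v n)[k]'hk

theorem occursAt_iff {A : Type*} {ω : ℕ → A} {x : List A} {i : ℕ} :
    OccursAt ω x i ↔ ∀ k, ∀ hk : k < x.length, ω (i + k) = x[k] := by
  unfold OccursAt seg
  constructor
  · intro h k hk
    have : (List.ofFn (fun k : Fin x.length => ω (i + k)))[k]'(by simpa using hk) = x[k] := by
      simp only [h]
    simpa using this
  · intro h
    apply List.ext_getElem
    · simp
    · intro k h1 h2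
      simpa using h k h2

/-- The segments of length `L` of `ω` starting at `i` and at `j` are equal. -/
def SegAgree {A : Type*} (ω : ℕ → A) (i j L : ℕ) : Prop :=
  ∀ k < L, ω (i + k) = ω (j + k)

/-- The segment of length `L` of `ω` starting at `i` occurs infinitely many times in `ω`. -/
def SegRecurs {A : Type*} (ω : ℕ → A) (i L : ℕ) : Prop :=
  ∀ N, ∃ j, N ≤ j ∧ SegAgree ω j i L

theorem OccursAt.iff_segAgree {A : Type*} {ω : ℕ → A} {x : List A} {i j : ℕ}
    (h : OccursAt ω x i) : OccursAt ω x j ↔ SegAgree ω j i x.length := by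
  rw [occursAt_iff] at h ⊢
  constructor
  · intro hj k hk
    rw [h k hk, hj k hk]
  · intro hj k hk
    rw [← h k hk, hj k hk]

theorem occursAt_seg {A : Type*} (ω : ℕ → A) (i L : ℕ) : OccursAt ω (seg ω i L) i := by
  simp [occursAt_iff, seg]

theorem almostPeriodic_iff_segRecurs {A : Type*} {ω : ℕ → A} :
    AlmostPeriodic ω ↔ ∀ i₀ L, SegRecurs ω i₀ L →
      ∃ l, ∀ i, ∃ j, i ≤ j ∧ j + L ≤ i + l ∧ SegAgree ω j i₀ L := by
  constructor
  · intro h i₀ L hr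
    have hx := occursAt_seg ω i₀ L
    have hlen : (seg ω i₀ L).length = L := by simp [seg]
    have := h (seg ω i₀ L)
    simp only [hx.iff_segAgree, hlen] at this
    exact this hr
  · intro h x hx
    obtain ⟨i₀, -, hi₀⟩ := hx 0
    simp only [hi₀.iff_segAgree] at hx ⊢
    exact h i₀ x.length hx

theorem SegRecurs.mono {A : Type*} {ω : ℕ → A} {i L M : ℕ} (h : SegRecurs ω i M) (hLM : L ≤ M) :
    SegRecurs ω i L := fun N =>
  let ⟨j, hj, hji⟩ := h N
  ⟨j, hj, fun k hk => hji k (hk.trans_le hLM)⟩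

theorem exists_forall_ge_segRecurs {A : Type*} [Finite A] (ω : ℕ → A) (L : ℕ) :
    ∃ N, ∀ i, N ≤ i → SegRecurs ω i L := by
  have key : ∀ c : Fin L → A, ∃ N, ∀ i, N ≤ i → (∀ k : Fin L, ω (i + k) = c k) →
      SegRecurs ω i L := by
    intro c
    by_cases hc : ∀ N, ∃ j, N ≤ j ∧ ∀ k : Fin L, ω (j + k) = c k
    · refine ⟨0, fun i _ hi N => ?_⟩
      obtain ⟨j, hj, hjc⟩ := hc N
      exact ⟨j, hj, fun k hk => (hjc ⟨k, hk⟩).trans (hi ⟨k, hk⟩).symm⟩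
    · push Not at hc
      obtain ⟨N, hN⟩ := hc
      refine ⟨N, fun i hi h => ?_⟩
      obtain ⟨k, hk⟩ := hN i hi
      exact absurd (h k) hk
  choose N hN using key
  obtain ⟨b, hb⟩ := Set.Finite.bddAbove (Set.finite_range N)
  exact ⟨b, fun i hi => hN (fun k => ω (i + k)) i ((hb ⟨_, rfl⟩).trans hi) fun _ => rfl⟩

theorem transState_add {A Q B : Type*} (f : Q × A → Q × List B) (q : Q) (α : ℕ → A) (i k : ℕ) :
    transState f (transState f q α i) (fun n => α (i + n)) k = transState f q α (i + k) := by
  induction k with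
  | zero => rfl
  | succ k ih =>
    rw [← add_assoc]
    simp only [transState, ih]

theorem transState_congr {A Q B : Type*} (f : Q × A → Q × List B) (q : Q) {α α' : ℕ → A} {k : ℕ}
    (h : ∀ n < k, α n = α' n) : transState f q α k = transState f q α' k := by
  induction k with
  | zero => rfl
  | succ k ih =>
    simp only [transState, ih fun n hn => h n (by omega), h k (by omega)]

/-- The sequence of pairs (state, input symbol) is almost periodic whenever the input is. -/
theorem AlmostPeriodic.prod_transState {A Q B : Type*} [Finite A] [Finite Q]
    (f : Q × A → Q × List B) (init : Q) {ω : ℕ → A} (hω : AlmostPeriodic ω) :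
    AlmostPeriodic fun n => (transState f init ω n, ω n) := by
  set γ : ℕ → Q × A := fun n => (transState f init ω n, ω n) with hγ
  rw [almostPeriodic_iff_segRecurs] at hω ⊢
  intro i₀ L hrec
  obtain rfl | hL := Nat.eq_zero_or_pos L
  · exact ⟨0, fun i => ⟨i, le_rfl, le_rfl, fun k hk => absurd hk (by omega)⟩⟩
  -- the states from which reading `ω(i)…ω(i+M-1)` meets the given segment of `γ`
  let G : ℕ → ℕ → Set Q := fun i M => {q | ∃ k, k + L ≤ M ∧ ∀ t < L,
    (transState f q (fun n => ω (i + n)) (k + t), ω (i + (k + t))) = γ (i₀ + t)}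
  have G_mono : ∀ i M M', M ≤ M' → G i M ⊆ G i M' := by
    rintro i M M' h q ⟨k, hk, hkt⟩
    exact ⟨k, hk.trans h, hkt⟩
  have G_congr : ∀ i j M, SegAgree ω i j M → G i M ⊆ G j M := by
    rintro i j M h q ⟨k, hk, hkt⟩
    refine ⟨k, hk, fun t ht => ?_⟩
    rw [← hkt t ht, h (k + t) (by omega),
      transState_congr f q (α := fun n => ω (j + n)) (α' := fun n => ω (i + n))
        fun n hn => (h n (by omega)).symm]
  have G_state : ∀ j M, transState f init ω j ∈ G j M ↔
      ∃ k, k + L ≤ M ∧ SegAgree γ (j + k) i₀ L := by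
    intro j M
    simp only [G, Set.mem_ofPred_eq, transState_add, SegAgree, hγ, add_assoc]
  obtain ⟨S, ⟨⟨i₁, M, hM, rfl⟩, hmax⟩⟩ :=
    (Set.toFinite {S | ∃ i M, SegRecurs ω i M ∧ G i M = S}).exists_maximal
      ⟨G 0 0, 0, 0, fun N => ⟨N, le_rfl, fun k hk => absurd hk (by omega)⟩, rfl⟩
  obtain ⟨l, hl⟩ := hω i₁ M hM
  obtain ⟨N, hN⟩ := exists_forall_ge_segRecurs ω (l + L)
  have back : ∀ m, N + l ≤ m → SegAgree γ m i₀ L →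
      ∃ m', m ≤ m' + l ∧ m' < m ∧ SegAgree γ m' i₀ L := by
    intro m hm hocc
    obtain ⟨j, hj, hjm, hag⟩ := hl (m - l)
    have hr : SegRecurs ω j (m + L - j) := (hN j (by omega)).mono (by omega)
    have hsub : G j (m + L - j) ⊆ G i₁ M :=
      hmax ⟨j, _, hr, rfl⟩ <|
        (G_congr i₁ j M fun k hk => (hag k hk).symm).trans (G_mono j _ _ (by omega))
    have hq : transState f init ω j ∈ G j M :=
      G_congr i₁ j M (fun k hk => (hag k hk).symm) <| hsub <| (G_state j _).2
        ⟨m - j, by omega, by rwa [show j + (m - j) = m by omega]⟩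
    obtain ⟨k, hk, hkocc⟩ := (G_state j M).1 hq
    exact ⟨j + k, by omega, by omega, hkocc⟩
  refine ⟨N + 2 * l + L, fun i => ?_⟩
  classical
  have hex := hrec (i + N + l)
  obtain ⟨hm, hocc⟩ := Nat.find_spec hex
  have hmin := fun m' => Nat.find_min hex (m := m')
  set m := Nat.find hex
  refine ⟨m, by omega, ?_, hocc⟩
  by_contra hlt
  obtain ⟨m', h1, h2, h3⟩ := back m (by omega) hocc
  exact hmin m' h2 ⟨by omega, h3⟩

theorem concatPos_succ {B : Type*} (v : ℕ → List B) (n : ℕ) :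
    concatPos v (n + 1) = concatPos v n + (v n).length :=
  Finset.sum_range_succ _ _

theorem concatPos_mono {B : Type*} (v : ℕ → List B) : Monotone (concatPos v) :=
  monotone_nat_of_le_succ fun n => by rw [concatPos_succ]; omega

theorem exists_concatPos_le_lt {B : Type*} {v : ℕ → List B} (hinf : ConcatInfinite v) (s : ℕ) :
    ∃ n, concatPos v n ≤ s ∧ s < concatPos v (n + 1) := by
  classical
  have hspec := Nat.find_spec (hinf s)
  have hmin := fun n => Nat.find_min (hinf s) (m := n)
  rcases hn : Nat.find (hinf s) with _ | n
  · rw [hn] at hspec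
    simp [concatPos] at hspec
  · rw [hn] at hspec hmin
    exact ⟨n, not_lt.1 (hmin n (by omega)), hspec⟩

theorem concatPos_add_of_segAgree {B : Type*} {v : ℕ → List B} {i j V : ℕ}
    (h : SegAgree v i j V) : concatPos v (i + V) + concatPos v j =
      concatPos v (j + V) + concatPos v i := by
  induction V with
  | zero => simp [add_comm]
  | succ V ih =>
    have h1 := ih fun k hk => h k (by omega)
    have h2 := h V (by omega)
    rw [← add_assoc, ← add_assoc, concatPos_succ, concatPos_succ, h2]
    omega

theorem IsConcatOf.apply_eq_of_segAgree {B : Type*} {β : ℕ → B} {v : ℕ → List B}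
    (hβ : IsConcatOf β v) {i j V : ℕ} (h : SegAgree v i j V) (t : ℕ)
    (ht : concatPos v j + t < concatPos v (j + V)) :
    β (concatPos v i + t) = β (concatPos v j + t) := by
  induction V with
  | zero => simp at ht
  | succ V ih =>
    have h' : SegAgree v i j V := fun k hk => h k (by omega)
    by_cases hlt : concatPos v j + t < concatPos v (j + V)
    · exact ih h' hlt
    · have hp := concatPos_add_of_segAgree h'
      have hv := h V (by omega)
      rw [← add_assoc, concatPos_succ] at ht
      obtain ⟨k, hk⟩ := Nat.exists_eq_add_of_le (not_lt.1 hlt)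
      have hk' : k < (v (j + V)).length := by omega
      rw [hk, show concatPos v i + t = concatPos v (i + V) + k by omega, hβ _ _ hk',
        hβ _ _ (by rwa [hv])]
      simp only [hv]

/-- The image of an almost periodic sequence under a morphism, if infinite, is almost periodic. -/
theorem AlmostPeriodic.of_isConcatOf {B C : Type*} [Finite C] {γ : ℕ → C}
    (hγ : AlmostPeriodic γ) (h : C → List B) {β : ℕ → B}
    (hinf : ConcatInfinite fun n => h (γ n)) (hβ : IsConcatOf β fun n => h (γ n)) :
    AlmostPeriodic β := by
  rw [almostPeriodic_iff_segRecurs] at hγ ⊢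
  set v : ℕ → List B := fun n => h (γ n) with hv
  have v_agree : ∀ {i j V}, SegAgree γ i j V → SegAgree v i j V :=
    fun hij k hk => congrArg h (hij k hk)
  obtain ⟨K, hK⟩ : ∃ K, ∀ n, (v n).length ≤ K := by
    obtain ⟨K, hK⟩ := Set.Finite.bddAbove (Set.finite_range fun c => (h c).length)
    exact ⟨K, fun n => hK ⟨γ n, rfl⟩⟩
  have pos_add_le : ∀ n k, concatPos v (n + k) ≤ concatPos v n + K * k := by
    intro n k
    induction k with
    | zero => simp
    | succ k ih =>
      have := hK (n + k)
      rw [← add_assoc, concatPos_succ, mul_add]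
      omega
  obtain ⟨W, hW⟩ : ∃ W, ∀ n, concatPos v n + 1 ≤ concatPos v (n + W) := by
    obtain ⟨N, hN⟩ := exists_forall_ge_segRecurs γ 1
    obtain ⟨n, hn1, hn2⟩ := exists_concatPos_le_lt hinf (concatPos v N)
    have hNn : N ≤ n := by
      by_contra hlt
      have := concatPos_mono v (show n + 1 ≤ N by omega)
      omega
    obtain ⟨W, hW⟩ := hγ n 1 (hN n hNn)
    refine ⟨W, fun i => ?_⟩
    obtain ⟨j, hij, hjW, hag⟩ := hW i
    have h1 := concatPos_add_of_segAgree (v_agree hag)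
    have h2 := concatPos_mono v hij
    have h3 := concatPos_mono v hjW
    omega
  have le_pos_add : ∀ n k, concatPos v n + k ≤ concatPos v (n + W * k) := by
    intro n k
    induction k with
    | zero => simp
    | succ k ih =>
      have := hW (n + W * k)
      rw [mul_add, mul_one, ← add_assoc n]
      omega
  intro s₀ L hrec
  set V := W * (K + L) with hVdef
  obtain ⟨N, hN⟩ := exists_forall_ge_segRecurs γ V
  obtain ⟨s, hs, hsocc⟩ := hrec (concatPos v N)
  obtain ⟨n, hn1, hn2⟩ := exists_concatPos_le_lt hinf s
  have hNn : N ≤ n := by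
    by_contra hlt
    have := concatPos_mono v (show n + 1 ≤ N by omega)
    omega
  have hV : s + L ≤ concatPos v (n + V) := by
    have h1 := le_pos_add n (K + L)
    rw [← hVdef] at h1
    have h2 := pos_add_le n 1
    omega
  obtain ⟨l, hl⟩ := hγ n V (hN n hNn)
  refine ⟨K + K * l, fun s₁ => ?_⟩
  obtain ⟨n₁, h1, h2⟩ := exists_concatPos_le_lt hinf s₁
  obtain ⟨j, hj, hjl, hag⟩ := hl (n₁ + 1)
  have hadd := concatPos_add_of_segAgree (v_agree hag)
  have h3 := concatPos_mono v hj
  have h4 := concatPos_mono v hjl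
  have h5 := pos_add_le (n₁ + 1) l
  have h6 := pos_add_le n₁ 1
  refine ⟨concatPos v j + (s - concatPos v n), by omega, by omega, fun k hk => ?_⟩
  rw [← hsocc k hk, add_assoc, hβ.apply_eq_of_segAgree (v_agree hag) _ (by omega)]
  congr 1
  omega

/-- If `T` is a finite transducer with input alphabet `A` and output alphabet `B`, `ω` is
an almost periodic sequence over `A`, and the output `T(ω) = v₀v₁v₂…` is an infinite
sequence `β`, then `β` is an almost periodic sequence over `B`. -/
theorem transducer_preserves_almostPeriodic {A B : Type*} [Fintype A] [Fintype B]
    (Q : Type*) [Fintype Q] (f : Q × A → Q × List B) (init : Q)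
    (ω : ℕ → A) (hω : AlmostPeriodic ω) (β : ℕ → B)
    (hinf : ConcatInfinite (transOut f init ω))
    (hβ : IsConcatOf β (transOut f init ω)) :
    AlmostPeriodic β :=
  (hω.prod_transState f init).of_isConcatOf (fun c => (f c).2) hinf hβ
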